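/- arXiv:1806.02196 — 2 statements merged into one kernel-verified Lean document; each statement's English description precedes it below -/
import Mathlib

section
/- Let f, f0, f1, g1, g2 : ℤ → ℂ with g1_k ≠ g2_k for all k ∈ ℤ, and let y : ℤ → ℂ satisfy the inhomogeneous equation y_{k+2} + f1_k·y_{k+1} + f0_k·y_k + f_k = 0 for all k ∈ ℤ. Define y1_k = (g2_k·y_k − y_{k+1})/(g2_k − g1_k) and y2_k = (y_{k+1} − g1_k·y_k)/(g2_k − g1_k). Then for every k ∈ ℤ: y1_k = T_{k,11}·y1_{k−1} + T_{k,12}·y2_{k−1} + f_{k−1}/(g2_k − g1_k) and y2_k = T_{k,21}·y1_{k−1} + T_{k,22}·y2_{k−1} − f_{k−1}/(g2_k − g1_k), where T_{k,11} = (f0_{k−1} + g1_{k−1}(g2_k + f1_{k−1}))/(g2_k − g1_k), T_{k,12} = (f0_{k−1} + g2_{k−1}(g2_k + f1_{k−1}))/(g2_k − g1_k), T_{k,21} = −(f0_{k−1} + g1_{k−1}(g1_k + f1_{k−1}))/(g2_k − g1_k), T_{k,22} = −(f0_{k−1} + g2_{k−1}(g1_k + f1_{k−1}))/(g2_k − g1_k).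 -/
/-- Transfer-matrix relation with forcing term for the decomposition of a
solution of the inhomogeneous second-order difference equation. -/
theorem stmt_2 (f f0 f1 g1 g2 : ℤ → ℂ) (hg : ∀ k : ℤ, g1 k ≠ g2 k)
    (y : ℤ → ℂ)
    (hy : ∀ k : ℤ, y (k + 2) + f1 k * y (k + 1) + f0 k * y k + f k = 0)
    (y1 y2 : ℤ → ℂ)
    (hy1 : ∀ k : ℤ, y1 k = (g2 k * y k - y (k + 1)) / (g2 k - g1 k))
    (hy2 : ∀ k : ℤ, y2 k = (y (k + 1) - g1 k * y k) / (g2 k - g1 k)) :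
    ∀ k : ℤ,
      y1 k = (f0 (k - 1) + g1 (k - 1) * (g2 k + f1 (k - 1))) / (g2 k - g1 k) * y1 (k - 1)
           + (f0 (k - 1) + g2 (k - 1) * (g2 k + f1 (k - 1))) / (g2 k - g1 k) * y2 (k - 1)
           + f (k - 1) / (g2 k - g1 k) ∧
      y2 k = -((f0 (k - 1) + g1 (k - 1) * (g1 k + f1 (k - 1))) / (g2 k - g1 k)) * y1 (k - 1)
           + -((f0 (k - 1) + g2 (k - 1) * (g1 k + f1 (k - 1))) / (g2 k - g1 k)) * y2 (k - 1)
           - f (k - 1) / (g2 k - g1 k) := by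
  intro k
  have hD : g2 (k - 1) - g1 (k - 1) ≠ 0 := sub_ne_zero.mpr (hg _).symm
  have e1 : k - 1 + 1 = k := by ring
  have e2 : k - 1 + 2 = k + 1 := by ring
  have h := hy (k - 1)
  have a1 := hy1 (k - 1)
  have a2 := hy2 (k - 1)
  rw [e1] at h a1 a2
  rw [e2] at h
  have s1 : y1 (k - 1) + y2 (k - 1) = y (k - 1) := by
    rw [a1, a2]; field_simp; ring
  have s2 : g1 (k - 1) * y1 (k - 1) + g2 (k - 1) * y2 (k - 1) = y k := by
    rw [a1, a2]; field_simp; ring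
  rw [hy1 k, hy2 k]
  simp only [div_eq_mul_inv]
  generalize (g2 k - g1 k)⁻¹ = D
  constructor
  · linear_combination (-D) * h - D * f0 (k - 1) * s1 - D * (g2 k + f1 (k - 1)) * s2
  · linear_combination D * h + D * f0 (k - 1) * s1 + D * (g1 k + f1 (k - 1)) * s2
end

section
/- Let f0, f1, g1, g2 : ℤ → ℂ with g1_k ≠ g2_k for all k ∈ ℤ, and suppose both g1 and g2 satisfy the Riccati-type equation f0_k + g1_k·(g1_{k+1} + f1_k) = 0 and f0_k + g2_k·(g2_{k+1} + f1_k) = 0 for all k ∈ ℤ. Let y : ℤ → ℂ satisfy y_{k+2} + f1_k·y_{k+1} + f0_k·y_k = 0 for all k, and define y1_k = (g2_k·y_k − y_{k+1})/(g2_k − g1_k), y2_k = (y_{k+1} − g1_k·y_k)/(g2_k − g1_k). Then the system decouples: for every k ∈ ℤ, y1_k = g1_{k−1}·y1_{k−1} and y2_k = g2_{k−1}·y2_{k−1}. -/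
/-- If both `g1` and `g2` satisfy the Riccati-type equation, the transfer
system decouples into two first-order recursions. -/
theorem stmt_5 (f0 f1 g1 g2 : ℤ → ℂ) (hg : ∀ k : ℤ, g1 k ≠ g2 k)
    (hr1 : ∀ k : ℤ, f0 k + g1 k * (g1 (k + 1) + f1 k) = 0)
    (hr2 : ∀ k : ℤ, f0 k + g2 k * (g2 (k + 1) + f1 k) = 0)
    (y : ℤ → ℂ)
    (hy : ∀ k : ℤ, y (k + 2) + f1 k * y (k + 1) + f0 k * y k = 0)
    (y1 y2 : ℤ → ℂ)
    (hy1 : ∀ k : ℤ, y1 k = (g2 k * y k - y (k + 1)) / (g2 k - g1 k))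
    (hy2 : ∀ k : ℤ, y2 k = (y (k + 1) - g1 k * y k) / (g2 k - g1 k)) :
    ∀ k : ℤ, y1 k = g1 (k - 1) * y1 (k - 1) ∧ y2 k = g2 (k - 1) * y2 (k - 1) := by
  intro k
  obtain ⟨m, rfl⟩ : ∃ m, k = m + 1 := ⟨k - 1, by ring⟩
  have e : m + 1 - 1 = m := by ring
  have e2 : m + 1 + 1 = m + 2 := by ring
  have h0 : g2 m - g1 m ≠ 0 := sub_ne_zero.mpr (hg m).symm
  have h1 : g2 (m + 1) - g1 (m + 1) ≠ 0 := sub_ne_zero.mpr (hg (m + 1)).symm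
  have r1 := hr1 m
  have r2 := hr2 m
  have h := hy m
  rw [e, hy1 (m + 1), hy1 m, hy2 (m + 1), hy2 m, e2]
  constructor
  · rw [← mul_div_assoc, div_eq_div_iff h1 h0]
    linear_combination (-(g2 m - g1 m)) * h + (g2 m - g1 m) * y m * r2
      + (y (m + 1) - g2 m * y m) * (r2 - r1)
  · rw [← mul_div_assoc, div_eq_div_iff h1 h0]
    linear_combination (g2 m - g1 m) * h - (g2 m - g1 m) * y m * r1
      - (y (m + 1) - g1 m * y m) * (r2 - r1)
end
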